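/- Let t ≥ 3 and let d ∈ ℝ^n with 0 < d_1 ≤ d_2 ≤ … ≤ d_n be such that ∑_{i=1}^n d_i x_i ≥ 1 is a valid inequality for K of pitch exactly t. Then: (a) d_1 < 1/(t−1); (b) the inequality ∑_{i=2}^n d_i x_i ≥ 1 − d_1 is valid for K and has pitch at most t−1; and (c) the inequality ∑_{i=2}^n d_i x_i ≥ (t−2)/(t−1) is valid for K. -/

import Mathlib

open Finset

/-- The MinKnap feasible set `K = {x ∈ {0,1}^n : ∑ i, p i * x i ≥ 1}`. -/
def MinKnapK (n : ℕ) (p : Fin n → ℝ) : Set (Fin n → ℝ) :=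
  {x | (∀ i, x i = 0 ∨ x i = 1) ∧ 1 ≤ ∑ i, p i * x i}

/-- The pitch of the inequality `∑ i ∈ T, w i * x i ≥ β`: the least `k` such that
every `k`-element subset `S ⊆ T` satisfies `∑ i ∈ S, w i ≥ β`. -/
noncomputable def pitch {ι : Type*} (T : Finset ι) (w : ι → ℝ) (β : ℝ) : ℕ :=
  sInf {k : ℕ | ∀ S ⊆ T, S.card = k → β ≤ ∑ i ∈ S, w i}

theorem stmt_9 (n : ℕ) (hn : 0 < n) (p : Fin n → ℝ) (hp : ∀ i, 0 ≤ p i ∧ p i ≤ 1)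
    (t : ℕ) (ht : 3 ≤ t)
    (d : Fin n → ℝ) (hd1 : 0 < d ⟨0, hn⟩) (hmono : Monotone d)
    -- ∑ i, d i * x i ≥ 1 is valid for K
    (hvalid : ∀ x ∈ MinKnapK n p, 1 ≤ ∑ i, d i * x i)
    -- and has pitch exactly t
    (hpitch : pitch univ d 1 = t) :
    -- (a) d 1 < 1/(t-1)
    d ⟨0, hn⟩ < 1 / ((t : ℝ) - 1) ∧
    -- (b) ∑_{i=2}^n d i * x i ≥ 1 - d 1 is valid for K and has pitch at most t-1
    (∀ x ∈ MinKnapK n p, 1 - d ⟨0, hn⟩ ≤ ∑ i ∈ univ.erase ⟨0, hn⟩, d i * x i) ∧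
    pitch (univ.erase ⟨0, hn⟩) d (1 - d ⟨0, hn⟩) ≤ t - 1 ∧
    -- (c) ∑_{i=2}^n d i * x i ≥ (t-2)/(t-1) is valid for K
    (∀ x ∈ MinKnapK n p,
      ((t : ℝ) - 2) / ((t : ℝ) - 1) ≤ ∑ i ∈ univ.erase ⟨0, hn⟩, d i * x i) := by
  classical
  have hne : {k : ℕ | ∀ S ⊆ (univ : Finset (Fin n)), S.card = k → (1:ℝ) ≤ ∑ i ∈ S, d i}.Nonempty := by
    refine ⟨n + 1, fun S _ hS => ?_⟩
    have := card_le_univ S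
    rw [hS, Fintype.card_fin] at this
    omega
  have hmem := Nat.sInf_mem hne
  have hpitch' := hpitch
  unfold pitch at hpitch'
  rw [hpitch'] at hmem
  have hnot : t - 1 ∉ {k : ℕ | ∀ S ⊆ (univ : Finset (Fin n)), S.card = k → (1:ℝ) ≤ ∑ i ∈ S, d i} := by
    apply Nat.notMem_of_lt_sInf
    rw [hpitch']
    omega
  simp only [Set.mem_setOf_eq, not_forall, not_le] at hnot
  obtain ⟨S, -, hS, hlt⟩ := hnot
  have ht' : (3:ℝ) ≤ t := by exact_mod_cast ht
  have hpos : (0:ℝ) < (t:ℝ) - 1 := by linarith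
  have h0 : ∀ i, d ⟨0, hn⟩ ≤ d i := fun i => hmono (Fin.mk_le_of_le_val (Nat.zero_le _))
  have hge := card_nsmul_le_sum S d (d ⟨0, hn⟩) (fun i _ => h0 i)
  rw [hS, nsmul_eq_mul, Nat.cast_sub (by omega), Nat.cast_one] at hge
  have ha : d ⟨0, hn⟩ < 1 / ((t : ℝ) - 1) := by
    rw [lt_div_iff₀ hpos]
    linarith [mul_comm (d ⟨0, hn⟩) ((t:ℝ) - 1)]
  have hb : ∀ x ∈ MinKnapK n p, 1 - d ⟨0, hn⟩ ≤ ∑ i ∈ univ.erase ⟨0, hn⟩, d i * x i := by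
    intro x hx
    have h1 := hvalid x hx
    rw [← add_sum_erase univ (fun i => d i * x i) (mem_univ (⟨0, hn⟩ : Fin n))] at h1
    rcases hx.1 ⟨0, hn⟩ with h | h <;> simp only [h] at h1 <;> linarith
  refine ⟨ha, hb, ?_, ?_⟩
  · apply Nat.sInf_le
    intro S hS hc
    have hn0 : (⟨0, hn⟩ : Fin n) ∉ S := fun h => by simpa using hS h
    have := hmem (insert ⟨0, hn⟩ S) (subset_univ _) (by rw [card_insert_of_notMem hn0]; omega)
    rw [sum_insert hn0] at this
    linarith
  · intro x hx
    have h1 := hb x hx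
    have : ((t : ℝ) - 2) / ((t : ℝ) - 1) = 1 - 1 / ((t : ℝ) - 1) := by
      field_simp
      ring
    linarith
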